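/- Let μ be the Haar probability measure on SU(2). Then for every 2×2 complex matrix R, ∫_{SU(2)} g·R·g† dμ(g) = (1/2)·tr(R)·I, where I is the 2×2 identity matrix and the integral is taken entrywise. -/

import Mathlib

open Matrix MeasureTheory

noncomputable instance : MeasurableSpace (Matrix (Fin 2) (Fin 2) ℂ) :=
  inferInstanceAs (MeasurableSpace (Fin 2 → Fin 2 → ℂ))

theorem measurable_matrix_entry (i j : Fin 2) :
    Measurable fun A : Matrix (Fin 2) (Fin 2) ℂ => A i j :=
  (measurable_pi_apply j).comp (measurable_pi_apply (X := fun _ => Fin 2 → ℂ) i)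

theorem measurable_mul_left_matrix (g : Matrix (Fin 2) (Fin 2) ℂ) :
    Measurable fun A : Matrix (Fin 2) (Fin 2) ℂ => g * A := by
  refine measurable_pi_lambda _ fun i => measurable_pi_lambda _ fun j => ?_
  simp only [Matrix.mul_apply]
  exact Finset.measurable_fun_sum _ fun k _ => (measurable_matrix_entry k j).const_mul (g i k)

theorem measurable_conj_entry (R : Matrix (Fin 2) (Fin 2) ℂ) (i j : Fin 2) :
    Measurable fun A : Matrix (Fin 2) (Fin 2) ℂ => (A * R * Aᴴ) i j := by
  have hstar (k l : Fin 2) : Measurable fun A : Matrix (Fin 2) (Fin 2) ℂ => star (A k l) :=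
    continuous_star.measurable.comp (measurable_matrix_entry k l)
  simp only [Matrix.mul_apply, Matrix.conjTranspose_apply]
  exact Finset.measurable_fun_sum _ fun k _ =>
    (Finset.measurable_fun_sum _ fun l _ =>
      (measurable_matrix_entry i l).mul_const (R l k)).mul (hstar j k)

theorem measurableSet_specialUnitaryGroup :
    MeasurableSet (Matrix.specialUnitaryGroup (Fin 2) ℂ : Set (Matrix (Fin 2) (Fin 2) ℂ)) := by
  have hset : (Matrix.specialUnitaryGroup (Fin 2) ℂ : Set (Matrix (Fin 2) (Fin 2) ℂ)) =
      (⋂ i, ⋂ j, {A : Matrix (Fin 2) (Fin 2) ℂ |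
        (A * (1 : Matrix (Fin 2) (Fin 2) ℂ) * Aᴴ) i j = (1 : Matrix (Fin 2) (Fin 2) ℂ) i j}) ∩
        {A : Matrix (Fin 2) (Fin 2) ℂ | A 0 0 * A 1 1 - A 0 1 * A 1 0 = 1} := by
    ext A
    simp only [SetLike.mem_coe, Matrix.mem_specialUnitaryGroup_iff, Matrix.mem_unitaryGroup_iff,
      Matrix.star_eq_conjTranspose, Matrix.det_fin_two, Set.mem_inter_iff, Set.mem_iInter,
      Set.mem_ofPred_eq, Matrix.mul_one, ← Matrix.ext_iff]
  rw [hset]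
  refine (MeasurableSet.iInter fun i => MeasurableSet.iInter fun j =>
    measurable_conj_entry 1 i j (measurableSet_singleton _)).inter ?_
  exact (((measurable_matrix_entry 0 0).mul (measurable_matrix_entry 1 1)).sub
    ((measurable_matrix_entry 0 1).mul (measurable_matrix_entry 1 0)))
      (measurableSet_singleton (1 : ℂ))

theorem norm_conj_entry_le {A : Matrix (Fin 2) (Fin 2) ℂ}
    (hA : A ∈ Matrix.unitaryGroup (Fin 2) ℂ) (R : Matrix (Fin 2) (Fin 2) ℂ) (i j : Fin 2) :
    ‖(A * R * Aᴴ) i j‖ ≤ ∑ k, ∑ l, ‖R l k‖ := by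
  simp only [Matrix.mul_apply, Matrix.conjTranspose_apply]
  refine norm_sum_le_of_le _ fun k _ => ?_
  rw [norm_mul, norm_star]
  refine (mul_le_of_le_one_right (norm_nonneg _) (entry_norm_bound_of_unitary hA j k)).trans
    (norm_sum_le_of_le _ fun l _ => ?_)
  rw [norm_mul]
  exact mul_le_of_le_one_left (norm_nonneg _) (entry_norm_bound_of_unitary hA i l)

/-- for the Haar probability measure `μ` on `SU(2)` (formalized as a Borel
probability measure on the space of 2×2 complex matrices which is concentrated on `SU(2)` and
invariant under left translation by every element of `SU(2)`), and every 2×2 complex matrix `R`,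
`∫ g·R·g† dμ(g) = (tr R / 2)·I` (entrywise integral). -/
theorem haar_su2_average_conj (μ : Measure (Matrix (Fin 2) (Fin 2) ℂ)) [IsProbabilityMeasure μ]
    (hsupp : μ (Matrix.specialUnitaryGroup (Fin 2) ℂ : Set (Matrix (Fin 2) (Fin 2) ℂ)) = 1)
    (hinv : ∀ g ∈ Matrix.specialUnitaryGroup (Fin 2) ℂ,
      Measure.map (fun A => g * A) μ = μ)
    (R : Matrix (Fin 2) (Fin 2) ℂ) :
    (Matrix.of fun i j => ∫ A, (A * R * Aᴴ) i j ∂μ) =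
      (R.trace / 2) • (1 : Matrix (Fin 2) (Fin 2) ℂ) := by
  have hmem : ∀ᵐ A ∂μ, A ∈ Matrix.specialUnitaryGroup (Fin 2) ℂ :=
    (mem_ae_iff_prob_eq_one measurableSet_specialUnitaryGroup).2 hsupp
  have hint (i j : Fin 2) : Integrable (fun A => (A * R * Aᴴ) i j) μ :=
    .of_bound (measurable_conj_entry R i j).aestronglyMeasurable (∑ k, ∑ l, ‖R l k‖)
      (hmem.mono fun A hA =>
        norm_conj_entry_le (Matrix.mem_specialUnitaryGroup_iff.1 hA).1 R i j)
  have hconj (g : Matrix (Fin 2) (Fin 2) ℂ) (hg : g ∈ Matrix.specialUnitaryGroup (Fin 2) ℂ)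
      (i j : Fin 2) :
      ∫ A, (A * R * Aᴴ) i j ∂μ = ∫ A, (g * (A * R * Aᴴ) * gᴴ) i j ∂μ := by
    conv_lhs => rw [← hinv g hg]
    rw [integral_map (measurable_mul_left_matrix g).aemeasurable
      (measurable_conj_entry R i j).aestronglyMeasurable]
    simp only [Matrix.conjTranspose_mul, Matrix.mul_assoc]
  have hD : !![Complex.I, 0; 0, -Complex.I] ∈ Matrix.specialUnitaryGroup (Fin 2) ℂ := by
    rw [Matrix.mem_specialUnitaryGroup_iff, Matrix.mem_unitaryGroup_iff]
    constructor
    · ext i j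
      fin_cases i <;> fin_cases j <;> simp [Matrix.mul_apply, Matrix.star_apply]
    · simp [Matrix.det_fin_two]
  have hW : !![0, 1; -1, 0] ∈ Matrix.specialUnitaryGroup (Fin 2) ℂ := by
    rw [Matrix.mem_specialUnitaryGroup_iff, Matrix.mem_unitaryGroup_iff]
    constructor
    · ext i j
      fin_cases i <;> fin_cases j <;> simp [Matrix.mul_apply, Matrix.star_apply]
    · simp [Matrix.det_fin_two]
  have hDX (X : Matrix (Fin 2) (Fin 2) ℂ) :
      !![Complex.I, 0; 0, -Complex.I] * X * !![Complex.I, 0; 0, -Complex.I]ᴴ =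
        !![X 0 0, -X 0 1; -X 1 0, X 1 1] := by
    ext i j
    fin_cases i <;> fin_cases j <;>
      simp [Matrix.mul_apply, Matrix.vecMul, dotProduct, Fin.sum_univ_two,
        mul_right_comm _ _ Complex.I]
  have hWX (X : Matrix (Fin 2) (Fin 2) ℂ) :
      !![0, 1; -1, 0] * X * !![0, 1; -1, 0]ᴴ = !![X 1 1, -X 1 0; -X 0 1, X 0 0] := by
    ext i j
    fin_cases i <;> fin_cases j <;>
      simp [Matrix.mul_apply, Matrix.vecMul, dotProduct, Fin.sum_univ_two]
  have h01 : ∫ A, (A * R * Aᴴ) 0 1 ∂μ = 0 := by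
    have h := hconj _ hD 0 1
    simp only [hDX] at h
    exact self_eq_neg.1 (h.trans (integral_neg _))
  have h10 : ∫ A, (A * R * Aᴴ) 1 0 ∂μ = 0 := by
    have h := hconj _ hD 1 0
    simp only [hDX] at h
    exact self_eq_neg.1 (h.trans (integral_neg _))
  have hdiag : ∫ A, (A * R * Aᴴ) 0 0 ∂μ = ∫ A, (A * R * Aᴴ) 1 1 ∂μ := by
    have h := hconj _ hW 0 0
    simp only [hWX] at h
    exact h
  have htrace : ∫ A, (A * R * Aᴴ) 0 0 ∂μ + ∫ A, (A * R * Aᴴ) 1 1 ∂μ = R.trace := by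
    rw [← integral_add (hint 0 0) (hint 1 1)]
    have h : ∀ᵐ A ∂μ, (A * R * Aᴴ) 0 0 + (A * R * Aᴴ) 1 1 = R.trace := hmem.mono fun A hA => by
      rw [← Matrix.trace_fin_two, Matrix.trace_mul_comm, ← Matrix.mul_assoc,
        ← Matrix.star_eq_conjTranspose,
        Matrix.mem_unitaryGroup_iff'.1 (Matrix.mem_specialUnitaryGroup_iff.1 hA).1,
        Matrix.one_mul]
    rw [integral_congr_ae h]
    simp
  have h00 : ∫ A, (A * R * Aᴴ) 0 0 ∂μ = R.trace / 2 := by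
    linear_combination (hdiag + htrace) / 2
  ext i j
  fin_cases i <;> fin_cases j
  · simpa using h00
  · simpa using h01
  · simpa using h10
  · simpa using hdiag.symm.trans h00
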